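/- arXiv:2509.17483 — 2 statements merged into one kernel-verified Lean document; each statement's English description precedes it below -/
import Mathlib

section
/- Fix η ∈ ℝ and define the Lagrangian L_η(p) = I(p) + η Σ_{i=1}^N x_i p_i. Let p be a probability vector with all p_i > 0, let Q*(i|j) = p_i · g(j|x_i) / Σ_k p_k · g(j|x_k) be its Bayes posterior, and let p' be the updated probability vector p'_i = exp(η x_i) · Π_{j=1}^K Q*(i|j)^{g(j|x_i)} / Σ_{k=1}^N exp(η x_k) · Π_{j=1}^K Q*(k|j)^{g(j|x_k)}. Then L_η(p') ≥ L_η(p); i.e., one full alternating-optimization step of the Blahut–Arimoto type algorithm does not decrease the Lagrangian objective. -/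
/-- Poisson channel law with dark current `lam`: `P(y|x) = (x+λ)^y e^{-(x+λ)}/y!`. -/
noncomputable def poissonP (lam x : ℝ) (y : ℕ) : ℝ :=
  (x + lam) ^ y * Real.exp (-(x + lam)) / (Nat.factorial y)

/-- Quantized transition probability: `g(j|x) = Σ_{y ∈ B_j} P(y|x)`, where the bins are
given by a bin-assignment map `bin : ℕ → Fin K` (monotone and surjective for a genuine
partition of ℕ into K nonempty consecutive integer intervals). -/
noncomputable def gq {K : ℕ} (lam : ℝ) (bin : ℕ → Fin K) (x : ℝ) (j : Fin K) : ℝ :=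
  ∑' y : {y : ℕ // bin y = j}, poissonP lam x (y : ℕ)

/-- Output pmf `G_p(j) = Σ_i p_i g(j|x_i)` for a finite input distribution `p`. -/
noncomputable def Gout {K N : ℕ} (lam : ℝ) (bin : ℕ → Fin K) (x : Fin N → ℝ)
    (p : Fin N → ℝ) (j : Fin K) : ℝ :=
  ∑ i, p i * gq lam bin (x i) j

/-- Mutual information `I(p) = Σ_i Σ_j p_i g(j|x_i) log( g(j|x_i)/G_p(j) )`
(with the convention `0·log(·) = 0`, realized by `Real.log 0 = 0` and vanishing
coefficients). -/
noncomputable def MIfin {K N : ℕ} (lam : ℝ) (bin : ℕ → Fin K) (x : Fin N → ℝ)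
    (p : Fin N → ℝ) : ℝ :=
  ∑ i, ∑ j, p i * gq lam bin (x i) j * Real.log (gq lam bin (x i) j / Gout lam bin x p j)

open Finset in
/-- The Gibbs inequality for positive weights of arbitrary total mass. -/
theorem sum_mul_log_sub_log_le {ι : Type*} (s : Finset ι) (a b : ι → ℝ)
    (ha : ∀ i, 0 < a i) (hb : ∀ i, 0 < b i) :
    ∑ i ∈ s, a i * (Real.log (b i) - Real.log (a i)) ≤ ∑ i ∈ s, b i - ∑ i ∈ s, a i := by
  rw [← sum_sub_distrib]
  refine sum_le_sum fun i _ => ?_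
  rw [← Real.log_div (hb i).ne' (ha i).ne']
  calc a i * Real.log (b i / a i) ≤ a i * (b i / a i - 1) :=
        mul_le_mul_of_nonneg_left (Real.log_le_sub_one_of_pos (div_pos (hb i) (ha i))) (ha i).le
    _ = b i - a i := by
        have := (ha i).ne'
        field_simp

open Finset in
/-- Data processing: passing two input weights through a channel does not increase their
relative entropy. -/
theorem sum_output_mul_log_le {ι κ : Type*} [Fintype ι] [Fintype κ] [Nonempty ι]
    (g : ι → κ → ℝ) (hg : ∀ i j, 0 < g i j) (hg1 : ∀ i, ∑ j, g i j = 1)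
    (p q : ι → ℝ) (hp : ∀ i, 0 < p i) (hq : ∀ i, 0 < q i) :
    ∑ i, ∑ j, q i * g i j *
        (Real.log (∑ k, q k * g k j) - Real.log (∑ k, p k * g k j))
      ≤ ∑ i, q i * (Real.log (q i) - Real.log (p i)) := by
  have hG : ∀ r : ι → ℝ, (∀ i, 0 < r i) → ∀ j, 0 < ∑ k, r k * g k j := fun r hr j =>
    sum_pos (fun i _ => mul_pos (hr i) (hg i j)) univ_nonempty
  have gibbs := sum_mul_log_sub_log_le (univ : Finset (ι × κ))
    (fun a => q a.1 * g a.1 a.2)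
    (fun a => p a.1 * g a.1 a.2 * (∑ k, q k * g k a.2) / ∑ k, p k * g k a.2)
    (fun a => mul_pos (hq _) (hg _ _))
    (fun a => div_pos (mul_pos (mul_pos (hp _) (hg _ _)) (hG q hq _)) (hG p hp _))
  have hmass : ∑ a : ι × κ, p a.1 * g a.1 a.2 * (∑ k, q k * g k a.2) / ∑ k, p k * g k a.2
      = ∑ a : ι × κ, q a.1 * g a.1 a.2 := by
    rw [Fintype.sum_prod_type_right, Fintype.sum_prod_type_right]
    refine sum_congr rfl fun j _ => ?_
    simp only
    rw [← sum_div, ← sum_mul, mul_div_cancel_left₀ _ (hG p hp j).ne']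
  rw [hmass, sub_self, Fintype.sum_prod_type] at gibbs
  rw [← sub_nonpos]
  refine le_trans (le_of_eq ?_) gibbs
  rw [← sum_sub_distrib]
  refine sum_congr rfl fun i _ => ?_
  have hsplit : q i * (Real.log (q i) - Real.log (p i))
      = ∑ j, q i * g i j * (Real.log (q i) - Real.log (p i)) := by
    rw [← sum_mul, ← mul_sum, hg1, mul_one]
  rw [hsplit, ← sum_sub_distrib]
  refine sum_congr rfl fun j _ => ?_
  simp only
  rw [Real.log_div (mul_pos (mul_pos (hp i) (hg i j)) (hG q hq j)).ne' (hG p hp j).ne',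
    Real.log_mul (mul_pos (hp i) (hg i j)).ne' (hG q hq j).ne',
    Real.log_mul (hp i).ne' (hg i j).ne', Real.log_mul (hq i).ne' (hg i j).ne']
  ring

open Finset in
/-- One Blahut–Arimoto step does not decrease the Lagrangian `I(p) + ∑ i, c i * p i` of a
finite channel with positive transition probabilities. -/
theorem blahut_arimoto_step_le {ι κ : Type*} [Fintype ι] [Fintype κ] [Nonempty ι]
    (g : ι → κ → ℝ) (hg : ∀ i j, 0 < g i j) (hg1 : ∀ i, ∑ j, g i j = 1)
    (c p w : ι → ℝ) (hp : ∀ i, 0 < p i) (hpsum : ∑ i, p i = 1)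
    (hw : ∀ i, w i = Real.exp (c i) * ∏ j, (p i * g i j / ∑ k, p k * g k j) ^ g i j)
    (q : ι → ℝ) (hq : ∀ i, q i = w i / ∑ k, w k) :
    ∑ i, ∑ j, p i * g i j * Real.log (g i j / ∑ k, p k * g k j) + ∑ i, c i * p i
      ≤ ∑ i, ∑ j, q i * g i j * Real.log (g i j / ∑ k, q k * g k j) + ∑ i, c i * q i := by
  have hG : ∀ r : ι → ℝ, (∀ i, 0 < r i) → ∀ j, 0 < ∑ k, r k * g k j := fun r hr j =>
    sum_pos (fun i _ => mul_pos (hr i) (hg i j)) univ_nonempty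
  have hpost : ∀ i j, 0 < p i * g i j / ∑ k, p k * g k j := fun i j =>
    div_pos (mul_pos (hp i) (hg i j)) (hG p hp j)
  have hw0 : ∀ i, 0 < w i := fun i => by
    rw [hw]
    exact mul_pos (Real.exp_pos _) (prod_pos fun j _ => Real.rpow_pos_of_pos (hpost i j) _)
  have hZ : 0 < ∑ k, w k := sum_pos (fun i _ => hw0 i) univ_nonempty
  have hq0 : ∀ i, 0 < q i := fun i => by rw [hq]; exact div_pos (hw0 i) hZ
  have hqsum : ∑ i, q i = 1 := by
    simp only [hq]
    rw [← sum_div, div_self hZ.ne']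
  have hlogw : ∀ i, Real.log (w i) = c i + Real.log (p i)
      + ∑ j, g i j * Real.log (g i j / ∑ k, p k * g k j) := fun i => by
    rw [hw, Real.log_mul (Real.exp_pos _).ne'
      (prod_pos fun j _ => Real.rpow_pos_of_pos (hpost i j) _).ne', Real.log_exp,
      Real.log_prod (fun j _ => (Real.rpow_pos_of_pos (hpost i j) _).ne'), add_assoc]
    congr 1
    have hsplit : Real.log (p i) = ∑ j, g i j * Real.log (p i) := by
      rw [← sum_mul, hg1, one_mul]
    rw [hsplit, ← sum_add_distrib]
    refine sum_congr rfl fun j _ => ?_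
    rw [Real.log_rpow (hpost i j), mul_div_assoc,
      Real.log_mul (hp i).ne' (div_pos (hg i j) (hG p hp j)).ne', mul_add]
  have hlogq : ∀ i, Real.log (q i) = Real.log (w i) - Real.log (∑ k, w k) := fun i => by
    rw [hq, Real.log_div (hw0 i).ne' hZ.ne']
  have hbefore : ∑ i, ∑ j, p i * g i j * Real.log (g i j / ∑ k, p k * g k j) + ∑ i, c i * p i
      = ∑ i, p i * (Real.log (q i) - Real.log (p i)) + Real.log (∑ k, w k) := by
    rw [← one_mul (Real.log (∑ k, w k)), ← hpsum, sum_mul, ← sum_add_distrib, ← sum_add_distrib]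
    refine sum_congr rfl fun i _ => ?_
    rw [hlogq, hlogw]
    simp only [mul_assoc, ← mul_sum]
    ring
  have hafter : ∑ i, ∑ j, q i * g i j * Real.log (g i j / ∑ k, q k * g k j) + ∑ i, c i * q i
      = ∑ i, q i * (Real.log (q i) - Real.log (p i)) + Real.log (∑ k, w k)
        - ∑ i, ∑ j, q i * g i j *
          (Real.log (∑ k, q k * g k j) - Real.log (∑ k, p k * g k j)) := by
    rw [← one_mul (Real.log (∑ k, w k)), ← hqsum, sum_mul, ← sum_add_distrib,
      ← sum_add_distrib, ← sum_sub_distrib]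
    refine sum_congr rfl fun i _ => ?_
    rw [hlogq, hlogw]
    have hterm : ∀ j, Real.log (g i j / ∑ k, q k * g k j)
        = Real.log (g i j / ∑ k, p k * g k j)
          - (Real.log (∑ k, q k * g k j) - Real.log (∑ k, p k * g k j)) := fun j => by
      rw [Real.log_div (hg i j).ne' (hG q hq0 j).ne',
        Real.log_div (hg i j).ne' (hG p hp j).ne']
      ring
    simp only [hterm, mul_assoc, ← mul_sum]
    simp only [mul_sub, sum_sub_distrib]
    ring
  have gibbs := sum_mul_log_sub_log_le univ p q hp hq0
  have processing := sum_output_mul_log_le g hg hg1 p q hp hq0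
  rw [hbefore, hafter]
  linarith

theorem hasSum_poissonP (lam x : ℝ) : HasSum (poissonP lam x) 1 := by
  have h := (NormedSpace.expSeries_div_hasSum_exp (𝔸 := ℝ) (x + lam)).mul_right
    (Real.exp (-(x + lam)))
  rw [← Real.exp_eq_exp_ℝ, ← Real.exp_add, add_neg_cancel, Real.exp_zero] at h
  exact h.congr_fun fun y => by unfold poissonP; ring

theorem poissonP_pos {lam x : ℝ} (h : 0 < x + lam) (y : ℕ) : 0 < poissonP lam x y := by
  unfold poissonP
  positivity

theorem gq_pos {K : ℕ} {lam x : ℝ} (h : 0 < x + lam) {bin : ℕ → Fin K}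
    (hbin : Function.Surjective bin) (j : Fin K) : 0 < gq lam bin x j := by
  obtain ⟨y, hy⟩ := hbin j
  exact ((hasSum_poissonP lam x).summable.subtype {y | bin y = j}).tsum_pos
    (fun y => (poissonP_pos h y.1).le) ⟨y, hy⟩ (poissonP_pos h y)

theorem sum_gq {K : ℕ} (lam x : ℝ) (bin : ℕ → Fin K) : ∑ j, gq lam bin x j = 1 := by
  have h := (hasSum_poissonP lam x).tsum_fiberwise bin
  rw [← tsum_fintype (L := .unconditional _)]
  exact h.tsum_eq

/-- one full alternating-optimization (Blahut–Arimoto type) step does not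
decrease the Lagrangian `L_η(p) = I(p) + η Σ_i x_i p_i`.  Here `p` is a strictly positive
input pmf, `Q*` its Bayes posterior, and `p'` the updated pmf
`p'_i ∝ exp(η x_i) Π_j Q*(i|j)^{g(j|x_i)}`. -/
theorem stmt5 {K N : ℕ} (hK : 2 ≤ K) (hN : 0 < N) (lam : ℝ) (hlam : 0 < lam)
    (bin : ℕ → Fin K) (hbin_mono : Monotone bin) (hbin_surj : Function.Surjective bin)
    (x : Fin N → ℝ) (hx : ∀ i, 0 ≤ x i) (hx_inj : Function.Injective x)
    (eta : ℝ)
    (p : Fin N → ℝ) (hp : ∀ i, 0 < p i) (hpsum : ∑ i, p i = 1)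
    (Qstar : Fin N → Fin K → ℝ)
    (hQstar : ∀ i j, Qstar i j =
      p i * gq lam bin (x i) j / ∑ k, p k * gq lam bin (x k) j)
    (p' : Fin N → ℝ)
    (hp' : ∀ i, p' i =
      Real.exp (eta * x i) * (∏ j, Qstar i j ^ gq lam bin (x i) j)
        / ∑ k, Real.exp (eta * x k) * (∏ j, Qstar k j ^ gq lam bin (x k) j)) :
    MIfin lam bin x p + eta * ∑ i, x i * p i
      ≤ MIfin lam bin x p' + eta * ∑ i, x i * p' i := by
  have hpos : ∀ i j, 0 < gq lam bin (x i) j := fun i j =>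
    gq_pos (add_pos_of_nonneg_of_pos (hx i) hlam) hbin_surj j
  have : Nonempty (Fin N) := ⟨⟨0, hN⟩⟩
  have h := blahut_arimoto_step_le (fun i j => gq lam bin (x i) j) hpos
    (fun i => sum_gq lam (x i) bin) (fun i => eta * x i) p _ hp hpsum (fun _ => rfl) p'
    (fun i => by rw [hp']; simp only [hQstar])
  simpa only [MIfin, Gout, Finset.mul_sum, mul_assoc] using h
end

section
/- For the K-level quantized discrete-time Poisson channel with finitely many candidate input points x_1, …, x_N ≥ 0, the maximum of the mutual information I over the probability simplex is attained at some probability vector whose support has at most K points; i.e., there exists a capacity-achieving input distribution supported on at most K mass points. -/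
open Finset in
/-- The mutual information of the quantized channel splits into a part linear in the input and
the entropy of the output. -/
theorem MIfin_eq_linear_add_entropy {K N : ℕ} {lam : ℝ} {bin : ℕ → Fin K} {x : Fin N → ℝ}
    (hg : ∀ i j, 0 ≤ gq lam bin (x i) j) {p : Fin N → ℝ} (hp : ∀ i, 0 ≤ p i) :
    MIfin lam bin x p =
      ∑ i, p i * (∑ j, gq lam bin (x i) j * Real.log (gq lam bin (x i) j)) +
        ∑ j, Real.negMulLog (Gout lam bin x p j) := by
  have hterm : ∀ i j, p i * gq lam bin (x i) j *
      Real.log (gq lam bin (x i) j / Gout lam bin x p j) =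
      p i * (gq lam bin (x i) j * Real.log (gq lam bin (x i) j)) -
        p i * gq lam bin (x i) j * Real.log (Gout lam bin x p j) := by
    intro i j
    by_cases h0 : p i * gq lam bin (x i) j = 0
    · rw [← mul_assoc, h0]; ring
    · have hG : 0 < Gout lam bin x p j :=
        (lt_of_le_of_ne (mul_nonneg (hp i) (hg i j)) (Ne.symm h0)).trans_le
          (single_le_sum (f := fun i => p i * gq lam bin (x i) j)
            (fun i _ => mul_nonneg (hp i) (hg i j)) (mem_univ i))
      rw [Real.log_div (right_ne_zero_of_mul h0) hG.ne']
      ring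
  simp only [MIfin, hterm, sum_sub_distrib, mul_sum]
  rw [sub_eq_add_neg, sum_comm (f := fun i j => p i * gq lam bin (x i) j *
    Real.log (Gout lam bin x p j)), ← sum_neg_distrib]
  congr 1
  refine sum_congr rfl fun j _ => ?_
  rw [← sum_mul, Real.negMulLog, Gout]
  ring

theorem poissonP_nonneg {lam x : ℝ} (h : 0 ≤ x + lam) (y : ℕ) : 0 ≤ poissonP lam x y := by
  unfold poissonP
  positivity

theorem gq_nonneg {K : ℕ} {lam x : ℝ} (h : 0 ≤ x + lam) (bin : ℕ → Fin K) (j : Fin K) :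
    0 ≤ gq lam bin x j :=
  tsum_nonneg fun y => poissonP_nonneg h y

/-- A signed vector of zero total mass which is annihilated by a row-stochastic matrix exists on
every set of more rows than there are columns. -/
theorem exists_sum_mul_eq_zero_of_card_lt {K N : ℕ} {g : Fin N → Fin K → ℝ}
    (hg : ∀ i, ∑ j, g i j = 1) {S : Finset (Fin N)} (hS : K < S.card) :
    ∃ v : Fin N → ℝ, v ≠ 0 ∧ (∀ i ∉ S, v i = 0) ∧ (∀ j, ∑ i, v i * g i j = 0) ∧
      ∑ i, v i = 0 := by
  have hdep : ¬ LinearIndepOn ℝ g (S : Set (Fin N)) := by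
    intro h
    have := LinearIndependent.fintype_card_le_finrank h
    simp at this
    omega
  rw [not_linearIndepOn_finset_iff] at hdep
  obtain ⟨f, hf, i₀, hi₀, hne⟩ := hdep
  have hcol : ∀ j, ∑ i, (if i ∈ S then f i else 0) * g i j = 0 := by
    intro j
    simpa [Finset.sum_apply, ite_mul, Finset.sum_ite_mem] using congrFun hf j
  refine ⟨fun i => if i ∈ S then f i else 0, fun h => hne ?_, fun i hi => by simp [hi], hcol, ?_⟩
  · simpa [hi₀] using congrFun h i₀
  · calc ∑ i, (if i ∈ S then f i else 0)
        = ∑ i, ∑ j, (if i ∈ S then f i else 0) * g i j := by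
          simp only [← Finset.mul_sum, hg, mul_one]
      _ = 0 := by rw [Finset.sum_comm]; exact Finset.sum_eq_zero fun j _ => hcol j

/-- Moving from a nonnegative vector along a direction with a negative entry, one first leaves the
support at some nonnegative time. -/
theorem exists_support_ssubset_add_smul {N : ℕ} {p v : Fin N → ℝ} (hp : ∀ i, 0 ≤ p i)
    (hsupp : ∀ i, p i = 0 → v i = 0) (hneg : ∃ i, v i < 0) :
    ∃ t : ℝ, 0 ≤ t ∧ (∀ i, 0 ≤ p i + t * v i) ∧
      {i | 0 < p i + t * v i} ⊂ {i | 0 < p i} := by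
  obtain ⟨k, hk, hmin⟩ := Finset.exists_min_image (Finset.univ.filter fun i => v i < 0)
    (fun i => p i / -v i) (by obtain ⟨i, hi⟩ := hneg; exact ⟨i, by simpa using hi⟩)
  simp only [Finset.mem_filter, Finset.mem_univ, true_and] at hk hmin
  have ht : 0 ≤ p k / -v k := div_nonneg (hp k) (by linarith)
  refine ⟨p k / -v k, ht, fun i => ?_, ?_, fun h => ?_⟩
  · rcases lt_or_ge (v i) 0 with hi | hi
    · have := (le_div_iff₀ (by linarith)).1 (hmin i hi)
      linarith
    · exact add_nonneg (hp i) (mul_nonneg ht hi)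
  · intro i hi
    refine lt_of_le_of_ne (hp i) fun h0 => ?_
    simp [← h0, hsupp i h0.symm] at hi
  · have hpk : 0 < p k := lt_of_le_of_ne (hp k) fun h0 => hk.ne (hsupp k h0.symm)
    have h1 : 0 < p k + p k / -v k * v k := h hpk
    have h2 : p k / -v k * v k = -p k := by field_simp [hk.ne]
    linarith

/-- An input whose support has more points than there are quantizer levels can be replaced by one
of strictly smaller support without losing mutual information. -/
theorem exists_MIfin_le_of_lt_ncard_support {K N : ℕ} {lam : ℝ} {bin : ℕ → Fin K}
    {x : Fin N → ℝ} (hg : ∀ i j, 0 ≤ gq lam bin (x i) j) {p : Fin N → ℝ}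
    (hp : p ∈ stdSimplex ℝ (Fin N)) (hcard : K < Set.ncard {i | 0 < p i}) :
    ∃ q ∈ stdSimplex ℝ (Fin N), MIfin lam bin x p ≤ MIfin lam bin x q ∧
      Set.ncard {i | 0 < q i} < Set.ncard {i | 0 < p i} := by
  set c : Fin N → ℝ := fun i => ∑ j, gq lam bin (x i) j * Real.log (gq lam bin (x i) j)
    with hc
  obtain ⟨v, hv0, hvS, hvG, hvsum, hslope⟩ : ∃ v : Fin N → ℝ, v ≠ 0 ∧
      (∀ i, p i = 0 → v i = 0) ∧ (∀ j, ∑ i, v i * gq lam bin (x i) j = 0) ∧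
      ∑ i, v i = 0 ∧ 0 ≤ ∑ i, v i * c i := by
    obtain ⟨v, h0, hS, hG, hsum⟩ := exists_sum_mul_eq_zero_of_card_lt
      (fun i => sum_gq lam (x i) bin) (S := Finset.univ.filter fun i => 0 < p i)
      (by rw [← Set.ncard_coe_finset]; simpa using hcard)
    have hS' : ∀ i, p i = 0 → v i = 0 := fun i hi => hS i (by simp [hi])
    rcases le_total 0 (∑ i, v i * c i) with h | h
    · exact ⟨v, h0, hS', hG, hsum, h⟩
    · refine ⟨-v, neg_ne_zero.2 h0, fun i hi => by simp [hS' i hi], fun j => ?_, ?_, ?_⟩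
      · simpa using hG j
      · simpa using hsum
      · simpa using h
  have hneg : ∃ i, v i < 0 := by
    by_contra! hnn
    exact hv0 (funext fun i =>
      (Finset.sum_eq_zero_iff_of_nonneg fun i _ => hnn i).1 hvsum i (Finset.mem_univ i))
  obtain ⟨t, ht, hq, hss⟩ := exists_support_ssubset_add_smul hp.1 hvS hneg
  have hGout : ∀ j, Gout lam bin x (fun i => p i + t * v i) j = Gout lam bin x p j := by
    intro j
    simp only [Gout, add_mul, Finset.sum_add_distrib, mul_assoc, ← Finset.mul_sum, hvG,
      mul_zero, add_zero]
  refine ⟨fun i => p i + t * v i, ⟨hq, ?_⟩, ?_, Set.ncard_lt_ncard hss⟩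
  · rw [Finset.sum_add_distrib, ← Finset.mul_sum, hvsum, hp.2, mul_zero, add_zero]
  · rw [MIfin_eq_linear_add_entropy hg hp.1, MIfin_eq_linear_add_entropy hg hq]
    simp only [hGout, add_mul, Finset.sum_add_distrib, mul_assoc, ← Finset.mul_sum]
    have := mul_nonneg ht hslope
    simp only [hc] at this
    linarith

theorem continuousOn_MIfin {K N : ℕ} {lam : ℝ} {bin : ℕ → Fin K} {x : Fin N → ℝ}
    (hg : ∀ i j, 0 ≤ gq lam bin (x i) j) :
    ContinuousOn (MIfin lam bin x) (stdSimplex ℝ (Fin N)) := by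
  refine ContinuousOn.congr (Continuous.continuousOn ?_)
    fun p hp => MIfin_eq_linear_add_entropy hg hp.1
  unfold Gout
  fun_prop

/-- for the K-level quantized discrete-time Poisson channel with finitely
many candidate input points, the maximum of the mutual information over the probability
simplex is attained at some pmf whose support `{i | p_i > 0}` has at most `K` points. -/
theorem stmt12 {K N : ℕ} (hK : 2 ≤ K) (hN : 0 < N) (lam : ℝ) (hlam : 0 ≤ lam)
    (bin : ℕ → Fin K) (hbin_mono : Monotone bin) (hbin_surj : Function.Surjective bin)
    (x : Fin N → ℝ) (hx : ∀ i, 0 ≤ x i) (hx_inj : Function.Injective x) :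
    ∃ p : Fin N → ℝ, (∀ i, 0 ≤ p i) ∧ (∑ i, p i = 1) ∧
      (∀ q : Fin N → ℝ, (∀ i, 0 ≤ q i) → (∑ i, q i = 1) →
        MIfin lam bin x q ≤ MIfin lam bin x p) ∧
      Set.ncard {i : Fin N | 0 < p i} ≤ K := by
  have hg : ∀ i j, 0 ≤ gq lam bin (x i) j := fun i j =>
    gq_nonneg (add_nonneg (hx i) hlam) bin j
  obtain ⟨p₀, hp₀, hmax₀⟩ := (isCompact_stdSimplex ℝ (Fin N)).exists_isMaxOn
    ⟨_, single_mem_stdSimplex ℝ (⟨0, hN⟩ : Fin N)⟩ (continuousOn_MIfin hg)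
  obtain ⟨p, ⟨hp, hmax⟩, hmin⟩ := exists_minimalFor_of_wellFoundedLT
    (fun p => p ∈ stdSimplex ℝ (Fin N) ∧ IsMaxOn (MIfin lam bin x) (stdSimplex ℝ (Fin N)) p)
    (fun p => Set.ncard {i | 0 < p i}) ⟨p₀, hp₀, hmax₀⟩
  refine ⟨p, hp.1, hp.2, fun q hq hq1 => hmax ⟨hq, hq1⟩, ?_⟩
  by_contra! hcard
  obtain ⟨q, hq, hle, hlt⟩ := exists_MIfin_le_of_lt_ncard_support hg hp hcard
  exact hlt.not_ge (hmin ⟨hq, fun r hr => (hmax hr).trans hle⟩ hlt.le)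
end
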